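/- Let K be a commutative Q-algebra and α ∈ ℕⁿ. In End_K(K[x₁,...,xₙ]), the operator x^α ∘ (∂^α x^α)^{-1} ∘ ∂^α is the projection onto the ideal (x^α) along the complement spanned by monomials x^β with x^β ∉ (x^α); that is, it sends x^β to x^β if α ≤ β componentwise and to 0 otherwise. -/

import Mathlib

set_option synthInstance.maxHeartbeats 1000000
set_option maxHeartbeats 1000000

open MvPolynomial

namespace MvPolynomial

variable {R σ : Type*} [CommSemiring R]

theorem pderiv_pow_monomial (i : σ) (k : ℕ) (m : σ →₀ ℕ) (c : R) :
    (((pderiv i).toLinearMap : Module.End R (MvPolynomial σ R)) ^ k) (monomial m c) =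
      monomial (m - Finsupp.single i k) (c * ((m i).descFactorial k : R)) := by
  induction k with
  | zero => simp
  | succ k ih =>
    rw [pow_succ', Module.End.mul_apply, ih,
      Derivation.coeFn_coe, pderiv_monomial, tsub_tsub, ← Finsupp.single_add,
      Nat.descFactorial_succ]
    simp [mul_comm, mul_left_comm]

theorem list_prod_pderiv_pow_monomial (α : σ → ℕ) (l : List σ) (hl : l.Nodup)
    (m : σ →₀ ℕ) (c : R) :
    (l.map fun i => ((pderiv i).toLinearMap : Module.End R (MvPolynomial σ R)) ^ α i).prod
        (monomial m c) =
      monomial (m - (l.map fun i => Finsupp.single i (α i)).sum)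
        (c * ((l.map fun i => (m i).descFactorial (α i)).prod : ℕ)) := by
  induction l with
  | nil => simp
  | cons i l ih =>
    obtain ⟨hi, hl'⟩ := List.nodup_cons.mp hl
    have hsum : (l.map fun j => Finsupp.single j (α j)).sum i = 0 := by
      clear ih hl hl'
      induction l with
      | nil => simp
      | cons j l ih =>
        rw [List.mem_cons, not_or] at hi
        simp [ih hi.2, Ne.symm hi.1]
    rw [List.map_cons, List.prod_cons, Module.End.mul_apply, ih hl', pderiv_pow_monomial,
      tsub_tsub, List.map_cons, List.sum_cons, List.map_cons, List.prod_cons,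
      Finsupp.tsub_apply, hsum, tsub_zero, add_comm]
    push_cast
    rw [mul_assoc, mul_comm (List.prod _)]

theorem ofFn_prod_pderiv_pow_monomial {n : ℕ} (α : Fin n → ℕ) (m : Fin n →₀ ℕ) (c : R) :
    (List.ofFn fun i : Fin n =>
        ((pderiv i).toLinearMap : Module.End R (MvPolynomial (Fin n) R)) ^ α i).prod
        (monomial m c) =
      monomial (m - Finsupp.equivFunOnFinite.symm α)
        (c * ((∏ i, (m i).descFactorial (α i) : ℕ) : R)) := by
  rw [List.ofFn_eq_map, list_prod_pderiv_pow_monomial α _ (List.nodup_finRange n),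
    ← List.ofFn_eq_map, ← List.ofFn_eq_map, List.sum_ofFn, List.prod_ofFn,
    Finsupp.equivFunOnFinite_symm_eq_sum]

theorem prod_X_pow_mul_monomial [Fintype σ] (α : σ → ℕ) (m : σ →₀ ℕ) (c : R) :
    (∏ i, X i ^ α i) * monomial m c = monomial (Finsupp.equivFunOnFinite.symm α + m) c := by
  have h : (∏ i, X i ^ α i : MvPolynomial σ R) =
      monomial (Finsupp.equivFunOnFinite.symm α) 1 := by
    rw [monomial_eq, Finsupp.prod_fintype _ _ (by simp)]
    simp
  rw [h, monomial_mul, one_mul]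

end MvPolynomial

/-- Let `K` be a commutative `ℚ`-algebra and `α ∈ ℕⁿ`. The operator
`∂^α ∘ x^α` on `K[x₁,…,xₙ]` is invertible, and for any (two-sided) inverse `g` of it, the
operator `x^α ∘ g ∘ ∂^α` sends the monomial `x^β` to `x^β` if `α ≤ β` componentwise and
to `0` otherwise, i.e. it is the projection onto the ideal `(x^α)` along the span of the
monomials not in `(x^α)`. -/
theorem stmt0 (K : Type*) [CommRing K] [Algebra ℚ K] (n : ℕ) (α : Fin n → ℕ) :
    let xα : Module.End K (MvPolynomial (Fin n) K) :=
      LinearMap.mulLeft K (∏ i, MvPolynomial.X i ^ α i)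
    let dα : Module.End K (MvPolynomial (Fin n) K) :=
      (List.ofFn (fun i : Fin n => ((MvPolynomial.pderiv i).toLinearMap :
        Module.End K (MvPolynomial (Fin n) K)) ^ α i)).prod
    (∃ g : Module.End K (MvPolynomial (Fin n) K),
        g * (dα * xα) = 1 ∧ (dα * xα) * g = 1) ∧
    ∀ g : Module.End K (MvPolynomial (Fin n) K),
      g * (dα * xα) = 1 → (dα * xα) * g = 1 →
      ∀ β : Fin n → ℕ,
        (xα * g * dα) (MvPolynomial.monomial (Finsupp.equivFunOnFinite.symm β) (1 : K)) =
          if ∀ i, α i ≤ β i then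
            MvPolynomial.monomial (Finsupp.equivFunOnFinite.symm β) (1 : K) else 0 := by
  intro xα dα
  have hd (m : Fin n →₀ ℕ) (c : K) : dα (monomial m c) = _ :=
    ofFn_prod_pderiv_pow_monomial α m c
  have hx (m : Fin n →₀ ℕ) (c : K) : xα (monomial m c) = _ :=
    prod_X_pow_mul_monomial α m c
  set a : Fin n →₀ ℕ := Finsupp.equivFunOnFinite.symm α with ha
  let w : (Fin n →₀ ℕ) → ℕ := fun m => ∏ i, ((a + m) i).descFactorial (α i)
  have hdx (m : Fin n →₀ ℕ) (c : K) :
      (dα * xα) (monomial m c) = monomial m (c * (w m : K)) := by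
    rw [Module.End.mul_apply, hx, hd, add_tsub_cancel_left]
  have hw (m : Fin n →₀ ℕ) : (w m : ℚ) ≠ 0 := by
    refine Nat.cast_ne_zero.mpr (Finset.prod_ne_zero_iff.mpr fun i _ => ?_)
    rw [Ne, Nat.descFactorial_eq_zero_iff_lt]
    simp [ha]
  have hwK (m : Fin n →₀ ℕ) : algebraMap ℚ K (w m : ℚ)⁻¹ * (w m : K) = 1 := by
    rw [← map_natCast (algebraMap ℚ K), ← map_mul, inv_mul_cancel₀ (hw m), map_one]
  constructor
  · let g : Module.End K (MvPolynomial (Fin n) K) :=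
      (basisMonomials (Fin n) K).constr K fun m => monomial m (algebraMap ℚ K (w m : ℚ)⁻¹)
    have hg (m : Fin n →₀ ℕ) (c : K) :
        g (monomial m c) = monomial m (c * algebraMap ℚ K (w m : ℚ)⁻¹) := by
      have h := (basisMonomials (Fin n) K).constr_basis K
        (fun m => monomial m (algebraMap ℚ K (w m : ℚ)⁻¹)) m
      rw [coe_basisMonomials] at h
      rw [← mul_one c, ← smul_eq_mul, ← smul_monomial, map_smul, h, smul_monomial]
      simp
    refine ⟨g, (basisMonomials (Fin n) K).ext fun m => ?_,
      (basisMonomials (Fin n) K).ext fun m => ?_⟩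
    · rw [coe_basisMonomials, Module.End.mul_apply, hdx, hg, mul_assoc, mul_comm (w m : K),
        hwK, mul_one, Module.End.one_apply]
    · rw [coe_basisMonomials, Module.End.mul_apply, hg, hdx, mul_assoc, hwK, mul_one,
        Module.End.one_apply]
  · intro g hg _ β
    set b : Fin n →₀ ℕ := Finsupp.equivFunOnFinite.symm β with hb
    split_ifs with h
    · have hab : a ≤ b := h
      have key : dα (monomial b (1 : K)) = (dα * xα) (monomial (b - a) 1) := by
        rw [Module.End.mul_apply, hx, add_tsub_cancel_of_le hab]
      rw [Module.End.mul_apply, key, Module.End.mul_apply, ← Module.End.mul_apply g, hg,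
        Module.End.one_apply, hx, add_tsub_cancel_of_le hab]
    · push Not at h
      obtain ⟨i, hi⟩ := h
      have h0 : ∏ i, (b i).descFactorial (α i) = 0 :=
        Finset.prod_eq_zero (Finset.mem_univ i) (Nat.descFactorial_eq_zero_iff_lt.mpr hi)
      rw [Module.End.mul_apply, hd, h0, Nat.cast_zero, mul_zero, map_zero, map_zero]
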